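/- Let P be a partially ordered set, p ∈ P an atom, and Y a string over P. If p^(0) ⇒ Y in the free pregroup on P, then p^(0) ⇒ Y is derivable using only (EXP) and (IND) steps, i.e. without any (CON) steps. -/

import Mathlib

/-! Free pregroup rewriting over a partially ordered set `P`.
A term is a pair `(p, n) : P × ℤ` representing `p^(n)`; a string is a list of terms. -/

/-- (CON): `X, p^(n), p^(n+1), Y → X, Y`. -/
inductive ConStep {P : Type*} [PartialOrder P] : List (P × ℤ) → List (P × ℤ) → Prop
  | con (X Y : List (P × ℤ)) (p : P) (n : ℤ) :
      ConStep (X ++ [(p, n), (p, n + 1)] ++ Y) (X ++ Y)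

/-- (EXP): `X, Y → X, p^(n+1), p^(n), Y`. -/
inductive ExpStep {P : Type*} [PartialOrder P] : List (P × ℤ) → List (P × ℤ) → Prop
  | exp (X Y : List (P × ℤ)) (p : P) (n : ℤ) :
      ExpStep (X ++ Y) (X ++ [(p, n + 1), (p, n)] ++ Y)

/-- (IND): `X, p^(n), Y → X, q^(n), Y` whenever `p ≤ q` and `n` even, or `q ≤ p` and `n` odd. -/
inductive IndStep {P : Type*} [PartialOrder P] : List (P × ℤ) → List (P × ℤ) → Prop
  | ind (X Y : List (P × ℤ)) (p q : P) (n : ℤ)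
      (h : (p ≤ q ∧ Even n) ∨ (q ≤ p ∧ Odd n)) :
      IndStep (X ++ [(p, n)] ++ Y) (X ++ [(q, n)] ++ Y)

/-- A rewriting step of the free pregroup: (CON), (EXP) or (IND). -/
def Step {P : Type*} [PartialOrder P] (a b : List (P × ℤ)) : Prop :=
  ConStep a b ∨ ExpStep a b ∨ IndStep a b

/-- The order `p^(n) ≤ q^(n)` of two terms with the same exponent. -/
def TermLE {P : Type*} [PartialOrder P] (n : ℤ) (p q : P) : Prop :=
  (p ≤ q ∧ Even n) ∨ (q ≤ p ∧ Odd n)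

theorem TermLE.refl {P : Type*} [PartialOrder P] (n : ℤ) (p : P) : TermLE n p p := by
  rcases Int.even_or_odd n with h | h
  · exact .inl ⟨le_rfl, h⟩
  · exact .inr ⟨le_rfl, h⟩

theorem TermLE.trans {P : Type*} [PartialOrder P] {n : ℤ} {p q r : P}
    (h₁ : TermLE n p q) (h₂ : TermLE n q r) : TermLE n p r := by
  rcases h₁ with ⟨h₁, e₁⟩ | ⟨h₁, e₁⟩ <;> rcases h₂ with ⟨h₂, e₂⟩ | ⟨h₂, e₂⟩
  · exact .inl ⟨h₁.trans h₂, e₁⟩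
  · exact absurd e₁ (Int.not_even_iff_odd.2 e₂)
  · exact absurd e₂ (Int.not_even_iff_odd.2 e₁)
  · exact .inr ⟨h₂.trans h₁, e₁⟩

theorem TermLE.of_add_one {P : Type*} [PartialOrder P] {n : ℤ} {p q : P}
    (h : TermLE (n + 1) p q) : TermLE n q p := by
  rcases h with ⟨h, e⟩ | ⟨h, e⟩
  · exact .inr ⟨h, by grind⟩
  · exact .inl ⟨h, by grind⟩

/-- Generalized contraction: `X, p^(n), q^(n+1), Y → X, Y` whenever `p^(n) ≤ q^(n)`. -/
inductive GenConStep {P : Type*} [PartialOrder P] : List (P × ℤ) → List (P × ℤ) → Prop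
  | con (X Y : List (P × ℤ)) (p q : P) (n : ℤ) (h : TermLE n p q) :
      GenConStep (X ++ [(p, n), (q, n + 1)] ++ Y) (X ++ Y)

theorem ConStep.genCon {P : Type*} [PartialOrder P] {S T : List (P × ℤ)}
    (h : ConStep S T) : GenConStep S T := by
  obtain ⟨X, Y, p, n⟩ := h
  exact .con X Y p p n (.refl n p)

theorem not_genCon_singleton {P : Type*} [PartialOrder P] (t : P × ℤ) (T : List (P × ℤ)) :
    ¬ GenConStep [t] T := by
  intro h
  generalize hS : [t] = S at h
  obtain ⟨X, Y, p, q, n, -⟩ := h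
  have := congrArg List.length hS
  simp at this
  omega

theorem append_pair_append_eq_cases {α : Type*} {X Y A B : List α} {u v s t : α}
    (h : X ++ [u, v] ++ Y = A ++ [s, t] ++ B) :
    (∃ M, X = A ++ [s, t] ++ M ∧ B = M ++ [u, v] ++ Y) ∨
    (∃ M, A = X ++ [u, v] ++ M ∧ Y = M ++ [s, t] ++ B) ∨
    (X = A ∧ u = s ∧ v = t ∧ Y = B) ∨
    (X = A ++ [s] ∧ u = t ∧ B = v :: Y) ∨
    (A = X ++ [u] ∧ v = s ∧ Y = t :: B) := by
  induction X generalizing A with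
  | nil =>
    match A with
    | [] => simp_all
    | [a] => simp_all
    | a :: b :: A => simp_all
  | cons x X ih =>
    match A with
    | [] => cases X <;> simp_all
    | a :: A =>
      simp only [List.cons_append, List.cons.injEq] at h
      obtain ⟨rfl, h⟩ := h
      simpa using ih (A := A) (by simpa using h)

theorem append_singleton_append_eq_cases {α : Type*} {X Y A B : List α} {u s t : α}
    (h : X ++ [u] ++ Y = A ++ [s, t] ++ B) :
    (∃ M, X = A ++ [s, t] ++ M ∧ B = M ++ [u] ++ Y) ∨
    (∃ M, A = X ++ [u] ++ M ∧ Y = M ++ [s, t] ++ B) ∨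
    (X = A ∧ u = s ∧ Y = t :: B) ∨
    (X = A ++ [s] ∧ u = t ∧ Y = B) := by
  induction X generalizing A with
  | nil => cases A <;> simp_all
  | cons x X ih =>
    match A with
    | [] => cases X <;> simp_all
    | a :: A =>
      simp only [List.cons_append, List.cons.injEq] at h
      obtain ⟨rfl, h⟩ := h
      simpa using ih (A := A) (by simpa using h)

theorem ExpStep.genCon_commute {P : Type*} [PartialOrder P] {S Z W : List (P × ℤ)}
    (h : ExpStep S Z) (hW : GenConStep Z W) :
    S = W ∨ IndStep S W ∨ ∃ V, GenConStep S V ∧ ExpStep V W := by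
  obtain ⟨X, Y, c, m⟩ := h
  generalize hZ : X ++ [(c, m + 1), (c, m)] ++ Y = Z at hW
  obtain ⟨A, B, a, b, n, hab⟩ := hW
  rcases append_pair_append_eq_cases hZ with
    ⟨M, rfl, rfl⟩ | ⟨M, rfl, rfl⟩ | ⟨rfl, h₁, h₂, rfl⟩ | ⟨rfl, h₁, rfl⟩ | ⟨rfl, h₁, rfl⟩
  · refine .inr (.inr ⟨A ++ M ++ Y, ?_, ?_⟩)
    · simpa using GenConStep.con A (M ++ Y) a b n hab
    · simpa using ExpStep.exp (A ++ M) Y c m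
  · refine .inr (.inr ⟨X ++ M ++ B, ?_, ?_⟩)
    · simpa using GenConStep.con (X ++ M) B a b n hab
    · simpa using ExpStep.exp X (M ++ B) c m
  · simp only [Prod.mk.injEq] at h₁ h₂
    omega
  · simp only [Prod.mk.injEq] at h₁
    obtain ⟨rfl, h₁⟩ := h₁
    obtain rfl : m = n := by omega
    exact .inr (.inl (by simpa using IndStep.ind A Y a c m hab))
  · simp only [Prod.mk.injEq] at h₁
    obtain ⟨rfl, rfl⟩ := h₁
    refine .inr (.inl ?_)
    have hba : TermLE (m + 1) b c := by
      rcases hab with ⟨h, e⟩ | ⟨h, e⟩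
      · exact .inr ⟨h, e.add_one⟩
      · exact .inl ⟨h, e.add_one⟩
    simpa using IndStep.ind X B b c (m + 1) hba

theorem IndStep.genCon_commute {P : Type*} [PartialOrder P] {S Z W : List (P × ℤ)}
    (h : IndStep S Z) (hW : GenConStep Z W) :
    GenConStep S W ∨ ∃ V, GenConStep S V ∧ IndStep V W := by
  obtain ⟨X, Y, c, d, m, hcd⟩ := h
  generalize hZ : X ++ [(d, m)] ++ Y = Z at hW
  obtain ⟨A, B, a, b, n, hab⟩ := hW
  rcases append_singleton_append_eq_cases hZ with
    ⟨M, rfl, rfl⟩ | ⟨M, rfl, rfl⟩ | ⟨rfl, h₁, rfl⟩ | ⟨rfl, h₁, rfl⟩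
  · refine .inr ⟨A ++ M ++ [(c, m)] ++ Y, ?_, ?_⟩
    · simpa using GenConStep.con A (M ++ [(c, m)] ++ Y) a b n hab
    · simpa using IndStep.ind (A ++ M) Y c d m hcd
  · refine .inr ⟨X ++ [(c, m)] ++ M ++ B, ?_, ?_⟩
    · simpa using GenConStep.con (X ++ [(c, m)] ++ M) B a b n hab
    · simpa using IndStep.ind X (M ++ B) c d m hcd
  · simp only [Prod.mk.injEq] at h₁
    obtain ⟨rfl, rfl⟩ := h₁
    exact .inl (by simpa using GenConStep.con X B c b m (TermLE.trans hcd hab))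
  · simp only [Prod.mk.injEq] at h₁
    obtain ⟨rfl, rfl⟩ := h₁
    exact .inl (by simpa using GenConStep.con A Y a c n (hab.trans (TermLE.of_add_one hcd)))

/-- A generalized contraction after expansions and induced steps either is absorbed
or can be performed first. -/
theorem expInd_or_genCon {P : Type*} [PartialOrder P] {S Z W : List (P × ℤ)}
    (h : Relation.ReflTransGen (fun a b => ExpStep a b ∨ IndStep a b) S Z)
    (hW : GenConStep Z W) :
    Relation.ReflTransGen (fun a b => ExpStep a b ∨ IndStep a b) S W ∨
      ∃ V, GenConStep S V ∧
        Relation.ReflTransGen (fun a b => ExpStep a b ∨ IndStep a b) V W := by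
  induction h generalizing W with
  | refl => exact .inr ⟨W, hW, .refl⟩
  | tail hS hs ih =>
    rcases hs with hs | hs
    · rcases hs.genCon_commute hW with rfl | h | ⟨V, hV, h⟩
      · exact .inl hS
      · exact .inl (hS.tail (.inr h))
      · rcases ih hV with h' | ⟨U, hU, h'⟩
        · exact .inl (h'.tail (.inl h))
        · exact .inr ⟨U, hU, h'.tail (.inl h)⟩
    · rcases hs.genCon_commute hW with h | ⟨V, hV, h⟩
      · exact ih h
      · rcases ih hV with h' | ⟨U, hU, h'⟩
        · exact .inl (h'.tail (.inr h))
        · exact .inr ⟨U, hU, h'.tail (.inr h)⟩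

/-- If `p^(0) ⇒ Y` for an atom `p` in the free pregroup on `P`, then the derivation
can be carried out using only (EXP) and (IND) steps, i.e. without any (CON) steps. -/
theorem derivation_from_atom_without_contractions {P : Type*} [PartialOrder P]
    (p : P) (Y : List (P × ℤ))
    (h : Relation.ReflTransGen Step [(p, (0 : ℤ))] Y) :
    Relation.ReflTransGen (fun a b => ExpStep a b ∨ IndStep a b) [(p, (0 : ℤ))] Y := by
  induction h with
  | refl => exact .refl
  | tail _ hs ih =>
    rcases hs with hs | hs
    · rcases expInd_or_genCon ih hs.genCon with h | ⟨V, hV, -⟩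
      · exact h
      · exact absurd hV (not_genCon_singleton _ _)
    · exact ih.tail hs
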